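/- The space 𝒞 endowed with the Calabi metric has no conjugate points: let u = u(t) be a unit-speed geodesic in 𝒞 defined on an interval I containing 0, i.e. ∫_M (∂_t u)² e^{u} dμ ≡ 1 and (e^{u/2})_{tt} + e^{u/2} = 0 pointwise, and let J = J(t) be a smooth section along u satisfying the Jacobi equation D_t(D_t J) = ⟨∂_t u, ∂_t u⟩_u J − ⟨∂_t u, J⟩_u ∂_t u pointwise on I × M. If J(0) = 0 and J(a) = 0 for some a ∈ I with a ≠ 0, then J is identically zero on I. -/

import Mathlib

open MeasureTheory Real

/-- The Calabi covariant derivative (with the normalization `Vol = 1/4`):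
`D_t v = ∂_t v + (1/2) v ∂_t u + 2 ∫ v (∂_t u) e^u dμ`. -/
noncomputable def calabiD {M : Type*} [MeasurableSpace M] (μ : Measure M)
    (u v : ℝ → M → ℝ) (t : ℝ) (p : M) : ℝ :=
  deriv (fun s => v s p) t + (1 / 2) * v t p * deriv (fun s => u s p) t
    + 2 * ∫ q, v t q * deriv (fun s => u s q) t * Real.exp (u t q) ∂μ

/-- A smooth curve of real functions on `M` defined on a set `I ⊆ ℝ`. -/
def SmoothCurveOn {M : Type*} [TopologicalSpace M] (u : ℝ → M → ℝ) (I : Set ℝ) : Prop :=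
  (∀ p, ContDiffOn ℝ (⊤ : ℕ∞) (fun t => u t p) I) ∧
    ∀ n : ℕ, ContinuousOn (fun z : ℝ × M => iteratedDeriv n (fun t => u t z.2) z.1)
      (I ×ˢ (Set.univ : Set M))

section CompactIntegrals

variable {M : Type*} [TopologicalSpace M] {I : Set ℝ}

lemma SmoothCurveOn.hasDerivAt_iteratedDeriv {u : ℝ → M → ℝ} (hu : SmoothCurveOn u I)
    (hI : IsOpen I) (n : ℕ) {t : ℝ} (ht : t ∈ I) (p : M) :
    HasDerivAt (fun s => iteratedDeriv n (fun r => u r p) s)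
      (iteratedDeriv (n + 1) (fun r => u r p) t) t := by
  have hc : ContDiffAt ℝ (⊤ : ℕ∞) (fun r => u r p) t := (hu.1 p).contDiffAt (hI.mem_nhds ht)
  rw [iteratedDeriv_succ]
  have hlt : (n : WithTop ℕ∞) < ((⊤ : ℕ∞) : WithTop ℕ∞) := by
    exact_mod_cast ENat.natCast_lt_top n
  refine DifferentiableAt.hasDerivAt ?_
  rw [iteratedDeriv_eq_equiv_comp]
  exact (LinearIsometryEquiv.differentiableAt _).comp t (hc.differentiableAt_iteratedFDeriv hlt)

lemma SmoothCurveOn.hasDerivAt {u : ℝ → M → ℝ} (hu : SmoothCurveOn u I) (hI : IsOpen I)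
    {t : ℝ} (ht : t ∈ I) (p : M) :
    HasDerivAt (fun s => u s p) (deriv (fun s => u s p) t) t := by
  simpa using hu.hasDerivAt_iteratedDeriv hI 0 ht p

lemma SmoothCurveOn.hasDerivAt_deriv {u : ℝ → M → ℝ} (hu : SmoothCurveOn u I) (hI : IsOpen I)
    {t : ℝ} (ht : t ∈ I) (p : M) :
    HasDerivAt (fun s => deriv (fun r => u r p) s) (iteratedDeriv 2 (fun s => u s p) t) t := by
  simpa using hu.hasDerivAt_iteratedDeriv hI 1 ht p

lemma SmoothCurveOn.continuousOn {u : ℝ → M → ℝ} (hu : SmoothCurveOn u I) :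
    ContinuousOn (fun z : ℝ × M => u z.1 z.2) (I ×ˢ Set.univ) := by
  simpa using hu.2 0

lemma SmoothCurveOn.continuousOn_deriv {u : ℝ → M → ℝ} (hu : SmoothCurveOn u I) :
    ContinuousOn (fun z : ℝ × M => deriv (fun s => u s z.2) z.1) (I ×ˢ Set.univ) := by
  simpa using hu.2 1

variable [CompactSpace M] [MeasurableSpace M] [BorelSpace M]
  (μ : Measure M) [IsFiniteMeasure μ]

lemma ContinuousOn.integrable_slice {F : ℝ → M → ℝ}
    (hF : ContinuousOn (fun z : ℝ × M => F z.1 z.2) (I ×ˢ Set.univ)) {t : ℝ} (ht : t ∈ I) :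
    Integrable (F t) μ := by
  have hc : Continuous (F t) := by
    rw [← continuousOn_univ]
    exact hF.comp (f := fun p : M => (t, p)) (by fun_prop) (fun p _ => ⟨ht, trivial⟩)
  exact hc.integrable_of_hasCompactSupport (HasCompactSupport.of_compactSpace _)

/-- Differentiation under the integral sign over a compact space. -/
lemma hasDerivAt_integral_of_continuousOn {F F' : ℝ → M → ℝ} (hI : IsOpen I)
    (hF : ContinuousOn (fun z : ℝ × M => F z.1 z.2) (I ×ˢ Set.univ))
    (hF' : ContinuousOn (fun z : ℝ × M => F' z.1 z.2) (I ×ˢ Set.univ))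
    (hd : ∀ t ∈ I, ∀ p, HasDerivAt (fun s => F s p) (F' t p) t) {t : ℝ} (ht : t ∈ I) :
    HasDerivAt (fun s => ∫ p, F s p ∂μ) (∫ p, F' t p ∂μ) t := by
  obtain ⟨ε, hε, hsub⟩ := Metric.nhds_basis_closedBall.mem_iff.1 (hI.mem_nhds ht)
  obtain ⟨C, hC⟩ := ((isCompact_closedBall t ε).prod isCompact_univ).exists_bound_of_continuousOn
    (hF'.mono (Set.prod_mono hsub subset_rfl))
  refine (hasDerivAt_integral_of_dominated_loc_of_deriv_le (bound := fun _ => C)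
    (Metric.closedBall_mem_nhds t hε) ?_ (hF.integrable_slice μ ht)
    (hF'.integrable_slice μ ht).aestronglyMeasurable ?_ (integrable_const C) ?_).2
  · filter_upwards [hI.mem_nhds ht] with s hs
    exact (hF.integrable_slice μ hs).aestronglyMeasurable
  · exact .of_forall fun p s hs => hC (s, p) ⟨hs, trivial⟩
  · exact .of_forall fun p s hs => hd s (hsub hs) p

end CompactIntegrals

section OrdinaryDifferentialEquations

variable {I : Set ℝ} {f f' : ℝ → ℝ} {a : ℝ}

lemma exists_eq_const_of_hasDerivAt_zero (hI : IsOpen I) (hI' : IsPreconnected I)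
    (hf : ∀ t ∈ I, HasDerivAt f 0 t) : ∃ k, ∀ t ∈ I, f t = k :=
  hI.exists_is_const_of_deriv_eq_zero hI'
    (fun t ht => (hf t ht).differentiableAt.differentiableWithinAt) fun t ht => (hf t ht).deriv

lemma eq_zero_of_second_deriv_eq_zero (hI : IsOpen I) (hI' : IsPreconnected I)
    (h0 : (0 : ℝ) ∈ I) (ha : a ∈ I) (ha0 : a ≠ 0)
    (hf : ∀ t ∈ I, HasDerivAt f (f' t) t) (hf' : ∀ t ∈ I, HasDerivAt f' 0 t)
    (hf0 : f 0 = 0) (hfa : f a = 0) : (∀ t ∈ I, f t = 0) ∧ ∀ t ∈ I, f' t = 0 := by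
  obtain ⟨k, hk⟩ := exists_eq_const_of_hasDerivAt_zero hI hI' hf'
  obtain ⟨l, hl⟩ := exists_eq_const_of_hasDerivAt_zero (f := fun t => f t - k * t) hI hI'
    fun t ht => ((hf t ht).sub ((hasDerivAt_id t).const_mul k)).congr_deriv (by simp [hk t ht])
  have hl0 : l = 0 := by simpa [hf0] using (hl 0 h0).symm
  have hk0 : k = 0 := by simpa [hfa, hl0, ha0] using hl a ha
  subst hl0 hk0
  exact ⟨fun t ht => by simpa using hl t ht, hk⟩

lemma eq_zero_of_second_deriv_eq_self (hI : IsOpen I) (hI' : IsPreconnected I)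
    (h0 : (0 : ℝ) ∈ I) (ha : a ∈ I) (ha0 : a ≠ 0)
    (hf : ∀ t ∈ I, HasDerivAt f (f' t) t) (hf' : ∀ t ∈ I, HasDerivAt f' (f t) t)
    (hf0 : f 0 = 0) (hfa : f a = 0) : ∀ t ∈ I, f t = 0 := by
  obtain ⟨k, hk⟩ := exists_eq_const_of_hasDerivAt_zero
    (f := fun t => (f' t + f t) * exp (-t)) hI hI' fun t ht =>
      (((hf' t ht).add (hf t ht)).mul (hasDerivAt_neg t).exp).congr_deriv
        (by simp only [Pi.add_apply]; ring)
  obtain ⟨l, hl⟩ := exists_eq_const_of_hasDerivAt_zero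
    (f := fun t => (f' t - f t) * exp t) hI hI' fun t ht =>
      (((hf' t ht).sub (hf t ht)).mul (Real.hasDerivAt_exp t)).congr_deriv
        (by simp only [Pi.sub_apply]; ring)
  have hsol : ∀ t ∈ I, 2 * f t = k * exp t - l * exp (-t) := fun t ht => by
    rw [← hk t ht, ← hl t ht]
    have : exp (-t) * exp t = 1 := by rw [← Real.exp_add]; simp
    linear_combination (-2 * f t) * this
  have hkl : k = l := by
    have := hsol 0 h0
    simp [hf0] at this
    linarith
  have hk0 : k = 0 := by
    have h := hsol a ha
    rw [hfa, ← hkl, mul_zero, ← mul_sub, eq_comm, mul_eq_zero, sub_eq_zero] at h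
    refine h.resolve_right fun he => ha0 ?_
    linarith [Real.exp_injective he]
  intro t ht
  have := hsol t ht
  rw [← hkl, hk0] at this
  linarith

end OrdinaryDifferentialEquations

/-- The space 𝒞 with the Calabi metric has no conjugate points: a Jacobi
field along a unit-speed geodesic vanishing at `0` and at some `a ≠ 0` vanishes identically. -/
theorem calabi_no_conjugate_points
    {M : Type*} [TopologicalSpace M] [CompactSpace M] [Nonempty M]
    [MeasurableSpace M] [BorelSpace M]
    (μ : Measure M) [IsFiniteMeasure μ] [μ.IsOpenPosMeasure]
    (hVol : (μ Set.univ).toReal = 1 / 4)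
    (I : Set ℝ) (hIopen : IsOpen I) (hIconn : IsPreconnected I) (hI0 : (0 : ℝ) ∈ I)
    (u : ℝ → M → ℝ) (hu : SmoothCurveOn u I)
    (huC : ∀ t ∈ I, ∫ p, Real.exp (u t p) ∂μ = 1 / 4)
    -- unit speed
    (hunit : ∀ t ∈ I, ∫ p, (deriv (fun s => u s p) t) ^ 2 * Real.exp (u t p) ∂μ = 1)
    -- geodesic equation
    (hgeo : ∀ t ∈ I, ∀ p, deriv (fun s => deriv (fun r => Real.exp (u r p / 2)) s) t
        + Real.exp (u t p / 2) = 0)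
    -- a smooth section `J` along `u`
    (J : ℝ → M → ℝ) (hJ : SmoothCurveOn J I)
    (hJT : ∀ t ∈ I, ∫ p, J t p * Real.exp (u t p) ∂μ = 0)
    -- the Jacobi equation `D_t(D_t J) = ⟨u',u'⟩ J − ⟨u',J⟩ u'`
    (hJac : ∀ t ∈ I, ∀ p, calabiD μ u (calabiD μ u J) t p
        = (∫ q, (deriv (fun s => u s q) t) ^ 2 * Real.exp (u t q) ∂μ) * J t p
          - (∫ q, deriv (fun s => u s q) t * J t q * Real.exp (u t q) ∂μ)
            * deriv (fun s => u s p) t)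
    (a : ℝ) (ha : a ∈ I) (ha0 : a ≠ 0)
    (hJ0 : J 0 = 0) (hJa : J a = 0) :
    ∀ t ∈ I, J t = 0 := by
  have du := fun t (ht : t ∈ I) p => hu.hasDerivAt hIopen ht p
  have du' := fun t (ht : t ∈ I) p => hu.hasDerivAt_deriv hIopen ht p
  have dJ := fun t (ht : t ∈ I) p => hJ.hasDerivAt hIopen ht p
  have dJ' := fun t (ht : t ∈ I) p => hJ.hasDerivAt_deriv hIopen ht p
  have cu := hu.continuousOn
  have cu' := hu.continuousOn_deriv
  have cu'' := hu.2 2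
  have cJ := hJ.continuousOn
  have cJ' := hJ.continuousOn_deriv
  have cJ'' := hJ.2 2
  unfold calabiD at hJac
  set u' : ℝ → M → ℝ := fun t p => deriv (fun s => u s p) t
  set J' : ℝ → M → ℝ := fun t p => deriv (fun s => J s p) t
  set u'' : ℝ → M → ℝ := fun t p => iteratedDeriv 2 (fun s => u s p) t
  set J'' : ℝ → M → ℝ := fun t p => iteratedDeriv 2 (fun s => J s p) t
  change ∀ t ∈ I, ∀ p, HasDerivAt (fun s => u s p) (u' t p) t at du
  change ∀ t ∈ I, ∀ p, HasDerivAt (fun s => u' s p) (u'' t p) t at du'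
  change ∀ t ∈ I, ∀ p, HasDerivAt (fun s => J s p) (J' t p) t at dJ
  change ∀ t ∈ I, ∀ p, HasDerivAt (fun s => J' s p) (J'' t p) t at dJ'
  change ContinuousOn (fun z : ℝ × M => u' z.1 z.2) _ at cu'
  change ContinuousOn (fun z : ℝ × M => u'' z.1 z.2) _ at cu''
  change ContinuousOn (fun z : ℝ × M => J' z.1 z.2) _ at cJ'
  change ContinuousOn (fun z : ℝ × M => J'' z.1 z.2) _ at cJ''
  change ∀ t ∈ I, ∫ p, (u' t p) ^ 2 * exp (u t p) ∂μ = 1 at hunit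
  have cE : ContinuousOn (fun z : ℝ × M => exp (u z.1 z.2)) (I ×ˢ Set.univ) := cu.rexp
  have dE : ∀ t ∈ I, ∀ p, HasDerivAt (fun s => exp (u s p)) (exp (u t p) * u' t p) t :=
    fun t ht p => (du t ht p).exp
  -- the geodesic equation in terms of `u`
  have geo : ∀ t ∈ I, ∀ p, u'' t p = -2 - (u' t p) ^ 2 / 2 := by
    intro t ht p
    have d1 : ∀ s ∈ I, HasDerivAt (fun r => exp (u r p / 2)) (exp (u s p / 2) * (u' s p / 2)) s :=
      fun s hs => ((du s hs p).div_const 2).exp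
    have e : (fun s => deriv (fun r => exp (u r p / 2)) s) =ᶠ[nhds t]
        fun s => exp (u s p / 2) * (u' s p / 2) := by
      filter_upwards [hIopen.mem_nhds ht] with s hs using (d1 s hs).deriv
    have h := hgeo t ht p
    have d2 : HasDerivAt (fun s => exp (u s p / 2) * (u' s p / 2))
        (exp (u t p / 2) * (u' t p / 2) * (u' t p / 2) + exp (u t p / 2) * (u'' t p / 2)) t :=
      (d1 t ht).mul ((du' t ht p).div_const 2)
    rw [e.deriv_eq, d2.deriv] at h
    have : exp (u t p / 2) * (u'' t p + 2 + (u' t p) ^ 2 / 2) = 0 := by linear_combination 2 * h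
    have := (mul_eq_zero.1 this).resolve_left (exp_pos _).ne'
    linarith
  have int_u' : ∀ t ∈ I, ∫ p, exp (u t p) * u' t p ∂μ = 0 := fun t ht => by
    refine (hasDerivAt_integral_of_continuousOn μ hIopen cE (cE.mul cu') dE ht).unique ?_
    refine (hasDerivAt_const t (1 / 4 : ℝ)).congr_of_eventuallyEq ?_
    filter_upwards [hIopen.mem_nhds ht] with s hs using huC s hs
  set c : ℝ → ℝ := fun t => ∫ p, J t p * u' t p * exp (u t p) ∂μ with hc
  set d : ℝ → ℝ := fun t => ∫ p, (J' t p + 1 / 2 * J t p * u' t p) * u' t p * exp (u t p) ∂μ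
    with hd
  have int_J' : ∀ t ∈ I, ∫ p, J' t p * exp (u t p) ∂μ = - c t := fun t ht => by
    have h := hasDerivAt_integral_of_continuousOn μ hIopen (cJ.mul cE)
      ((cJ'.mul cE).add (cJ.mul (cE.mul cu'))) (F := fun t p => J t p * exp (u t p))
      (F' := fun t p => J' t p * exp (u t p) + J t p * (exp (u t p) * u' t p))
      (fun t ht p => (dJ t ht p).mul (dE t ht p)) ht
    have h0 := h.unique ((hasDerivAt_const t (0 : ℝ)).congr_of_eventuallyEq (by
      filter_upwards [hIopen.mem_nhds ht] with s hs using hJT s hs))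
    rw [integral_add ((cJ'.mul cE).integrable_slice μ (F := fun t p => J' t p * exp (u t p)) ht)
      ((cJ.mul (cE.mul cu')).integrable_slice μ
        (F := fun t p => J t p * (exp (u t p) * u' t p)) ht)] at h0
    have : c t = ∫ p, J t p * (exp (u t p) * u' t p) ∂μ := by
      refine integral_congr_ae (.of_forall fun p => ?_)
      dsimp only
      ring
    linarith
  have dc : ∀ t ∈ I, HasDerivAt c (d t) t := fun t ht => by
    have h := hasDerivAt_integral_of_continuousOn μ hIopen ((cJ.mul cu').mul cE)
      ((((cJ'.mul cu').add (cJ.mul cu'')).mul cE).add ((cJ.mul cu').mul (cE.mul cu')))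
      (F := fun t p => J t p * u' t p * exp (u t p))
      (F' := fun t p => (J' t p * u' t p + J t p * u'' t p) * exp (u t p)
        + J t p * u' t p * (exp (u t p) * u' t p))
      (fun t ht p => ((dJ t ht p).mul (du' t ht p)).mul (dE t ht p)) ht
    convert h using 1
    have e : ∀ p, (J' t p * u' t p + J t p * u'' t p) * exp (u t p)
        + J t p * u' t p * (exp (u t p) * u' t p)
        = (J' t p + 1 / 2 * J t p * u' t p) * u' t p * exp (u t p)
          - 2 * (J t p * exp (u t p)) := fun p => by
      rw [geo t ht p]; ring
    simp only [e]
    rw [integral_sub (((cJ'.add ((continuousOn_const.mul cJ).mul cu')).mul cu').mul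
        cE |>.integrable_slice μ
        (F := fun t p => (J' t p + 1 / 2 * J t p * u' t p) * u' t p * exp (u t p)) ht)
      (((cJ.mul cE).integrable_slice μ (F := fun t p => J t p * exp (u t p)) ht).const_mul 2),
      integral_const_mul, hJT t ht]
    simp [hd]
  -- the Jacobi equation written out
  have jac : ∀ t ∈ I, ∀ p, J'' t p = 2 * J t p - J' t p * u' t p - 2 * c t * u' t p - 4 * d t := by
    intro t ht p
    have h := hJac t ht p
    have h1 : HasDerivAt (fun s => J' s p + 1 / 2 * J s p * u' s p + 2 * c s)
        (J'' t p + (1 / 2 * J' t p * u' t p + 1 / 2 * J t p * u'' t p) + 2 * d t) t :=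
      ((dJ' t ht p).add (((dJ t ht p).const_mul (1 / 2)).mul (du' t ht p))).add
        ((dc t ht).const_mul 2)
    have h2 : ∫ q, (J' t q + 1 / 2 * J t q * u' t q + 2 * c t) * u' t q * exp (u t q) ∂μ
        = d t := by
      have e : ∀ q, (J' t q + 1 / 2 * J t q * u' t q + 2 * c t) * u' t q * exp (u t q)
          = (J' t q + 1 / 2 * J t q * u' t q) * u' t q * exp (u t q)
            + 2 * c t * (exp (u t q) * u' t q) := fun q => by ring
      simp only [e]
      rw [integral_add (((cJ'.add ((continuousOn_const.mul cJ).mul cu')).mul cu').mul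
          cE |>.integrable_slice μ
          (F := fun t p => (J' t p + 1 / 2 * J t p * u' t p) * u' t p * exp (u t p)) ht)
        (((cE.mul cu').integrable_slice μ (F := fun t p => exp (u t p) * u' t p) ht).const_mul _),
        integral_const_mul, int_u' t ht, mul_zero, add_zero]
    have h3 : ∫ q, u' t q * J t q * exp (u t q) ∂μ = c t := by
      simp only [hc, mul_comm (u' t _)]
    change deriv (fun s => J' s p + 1 / 2 * J s p * u' s p + 2 * c s) t
      + 1 / 2 * (J' t p + 1 / 2 * J t p * u' t p + 2 * c t) * u' t p
      + 2 * ∫ q, (J' t q + 1 / 2 * J t q * u' t q + 2 * c t) * u' t q * exp (u t q) ∂μ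
      = (∫ q, (u' t q) ^ 2 * exp (u t q) ∂μ) * J t p
        - (∫ q, u' t q * J t q * exp (u t q) ∂μ) * u' t p at h
    rw [h1.deriv, h2, h3, hunit t ht, geo t ht p] at h
    linear_combination h
  have dd : ∀ t ∈ I, HasDerivAt d 0 t := fun t ht => by
    have h := hasDerivAt_integral_of_continuousOn μ hIopen
      (((cJ'.add ((continuousOn_const.mul cJ).mul cu')).mul cu').mul cE)
      (((((cJ''.add (((continuousOn_const.mul cJ').mul cu').add
        ((continuousOn_const.mul cJ).mul cu''))).mul cu').add
        ((cJ'.add ((continuousOn_const.mul cJ).mul cu')).mul cu'')).mul cE).add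
        (((cJ'.add ((continuousOn_const.mul cJ).mul cu')).mul cu').mul (cE.mul cu')))
      (F := fun t p => (J' t p + 1 / 2 * J t p * u' t p) * u' t p * exp (u t p))
      (F' := fun t p => ((J'' t p + (1 / 2 * J' t p * u' t p + 1 / 2 * J t p * u'' t p)) * u' t p
        + (J' t p + 1 / 2 * J t p * u' t p) * u'' t p) * exp (u t p)
        + (J' t p + 1 / 2 * J t p * u' t p) * u' t p * (exp (u t p) * u' t p))
      (fun t ht p => (((dJ' t ht p).add (((dJ t ht p).const_mul (1 / 2)).mul (du' t ht p))).mul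
        (du' t ht p)).mul (dE t ht p)) ht
    convert h using 1
    have e : ∀ p, ((J'' t p + (1 / 2 * J' t p * u' t p + 1 / 2 * J t p * u'' t p)) * u' t p
        + (J' t p + 1 / 2 * J t p * u' t p) * u'' t p) * exp (u t p)
        + (J' t p + 1 / 2 * J t p * u' t p) * u' t p * (exp (u t p) * u' t p)
        = -2 * c t * ((u' t p) ^ 2 * exp (u t p)) + -4 * d t * (exp (u t p) * u' t p)
          + -2 * (J' t p * exp (u t p)) := fun p => by
      rw [jac t ht p, geo t ht p]; ring
    have i1 := ((cu'.pow 2).mul cE).integrable_slice μ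
      (F := fun t p => (u' t p) ^ 2 * exp (u t p)) ht |>.const_mul (-2 * c t)
    have i2 := (cE.mul cu').integrable_slice μ
      (F := fun t p => exp (u t p) * u' t p) ht |>.const_mul (-4 * d t)
    have i3 := (cJ'.mul cE).integrable_slice μ
      (F := fun t p => J' t p * exp (u t p)) ht |>.const_mul (-2)
    simp only [e]
    have i12 : Integrable (fun p => -2 * c t * ((u' t p) ^ 2 * exp (u t p))
        + -4 * d t * (exp (u t p) * u' t p)) μ := i1.add i2
    rw [integral_add i12 i3, integral_add i1 i2, integral_const_mul, integral_const_mul,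
      integral_const_mul, hunit t ht, int_u' t ht, int_J' t ht]
    ring
  obtain ⟨c_zero, d_zero⟩ := eq_zero_of_second_deriv_eq_zero hIopen hIconn hI0 ha ha0 dc dd
    (by simp [hc, hJ0]) (by simp [hc, hJa])
  intro t ht
  funext p
  have dw : ∀ s ∈ I, HasDerivAt (fun r => exp (u r p / 2)) (exp (u s p / 2) * (u' s p / 2)) s :=
    fun s hs => ((du s hs p).div_const 2).exp
  have hX := eq_zero_of_second_deriv_eq_self (f := fun s => J s p * exp (u s p / 2))
    (f' := fun s => J' s p * exp (u s p / 2) + J s p * (exp (u s p / 2) * (u' s p / 2)))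
    hIopen hIconn hI0 ha ha0 (fun s hs => (dJ s hs p).mul (dw s hs))
    (fun s hs => (((dJ' s hs p).mul (dw s hs)).add
      ((dJ s hs p).mul ((dw s hs).mul ((du' s hs p).div_const 2)))).congr_deriv (by
        simp only [Pi.mul_apply]
        rw [jac s hs p, geo s hs p, c_zero s hs, d_zero s hs]
        ring))
    (by simp [hJ0]) (by simp [hJa]) t ht
  exact (mul_eq_zero.1 hX).resolve_right (exp_pos _).ne'
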